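/- For every h ≥ 2, the additive spectrum N(h), the set of all additive eigenvalues of order h, is an interval of the form (0, η_h) or (0, η_h] for some η_h with 0 < η_h ≤ 1/h!. -/

import Mathlib

/-- `α` is an additive eigenvalue of order `h`: there is a strictly increasing sequence
of nonnegative integers forming an asymptotic basis of order `h` with `a_n ~ α n^h`. -/
def IsAdditiveEigenvalue (h : ℕ) (α : ℝ) : Prop :=
  ∃ a : ℕ → ℕ, StrictMono a ∧
    (∃ n₀ : ℕ, ∀ n : ℕ, n₀ ≤ n →
      ∃ c : Fin h → ℕ, (∀ i, c i ∈ Set.range a) ∧ ∑ i, c i = n) ∧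
    Filter.Tendsto (fun n : ℕ => (a n : ℝ) / (α * (n : ℝ) ^ h)) Filter.atTop (nhds 1)

open Filter Topology

section CountingFunction

open scoped Classical in
/-- The number of elements of `A` smaller than `x`. -/
noncomputable def countBelow (A : Set ℕ) (x : ℕ) : ℕ := Nat.count (· ∈ A) x

/-- Every sufficiently large integer is a sum of `h` elements of `A`. -/
def IsAsymptoticBasis (h : ℕ) (A : Set ℕ) : Prop :=
  ∃ n₀ : ℕ, ∀ n : ℕ, n₀ ≤ n → ∃ c : Fin h → ℕ, (∀ i, c i ∈ A) ∧ ∑ i, c i = n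

/-- The number of elements of `A` below `x` is asymptotic to `γ x ^ (1 / h)`. -/
def HasRootCount (h : ℕ) (A : Set ℕ) (γ : ℝ) : Prop :=
  Tendsto (fun x : ℕ => (countBelow A x : ℝ) / (x : ℝ) ^ (h : ℝ)⁻¹) atTop (𝓝 γ)

lemma IsAsymptoticBasis.mono {h : ℕ} {A B : Set ℕ} (hA : IsAsymptoticBasis h A) (hAB : A ⊆ B) :
    IsAsymptoticBasis h B := by
  obtain ⟨n₀, H⟩ := hA
  refine ⟨n₀, fun n hn => ?_⟩
  obtain ⟨c, hc, hs⟩ := H n hn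
  exact ⟨c, fun i => hAB (hc i), hs⟩

lemma countBelow_zero (A : Set ℕ) : countBelow A 0 = 0 := by simp [countBelow]

open scoped Classical in
lemma countBelow_succ (A : Set ℕ) (x : ℕ) :
    countBelow A (x + 1) = countBelow A x + if x ∈ A then 1 else 0 :=
  Nat.count_succ _ _

open scoped Classical in
lemma countBelow_mono (A : Set ℕ) : Monotone (countBelow A) := Nat.count_monotone _

open scoped Classical in
lemma countBelow_eq_card (A : Set ℕ) (x : ℕ) :
    countBelow A x = ((Finset.range x).filter (· ∈ A)).card :=
  Nat.count_eq_card_filter_range _ _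

lemma countBelow_range {a : ℕ → ℕ} (ha : StrictMono a) (n : ℕ) :
    countBelow (Set.range a) (a n) = n := by
  classical
  rw [countBelow_eq_card]
  have : (Finset.range (a n)).filter (· ∈ Set.range a) = (Finset.range n).image a := by
    ext x
    simp only [Finset.mem_filter, Finset.mem_range, Set.mem_range, Finset.mem_image]
    constructor
    · rintro ⟨hx, m, rfl⟩
      exact ⟨m, ha.lt_iff_lt.1 hx, rfl⟩
    · rintro ⟨m, hm, rfl⟩
      exact ⟨ha hm, m, rfl⟩
  rw [this, Finset.card_image_of_injective _ ha.injective, Finset.card_range]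

lemma tendsto_natCast_rpow_inv {h : ℕ} (hh : h ≠ 0) :
    Tendsto (fun x : ℕ => (x : ℝ) ^ (h : ℝ)⁻¹) atTop atTop :=
  (tendsto_rpow_atTop (by positivity)).comp tendsto_natCast_atTop_atTop

lemma HasRootCount.of_tendsto {h : ℕ} (hh : h ≠ 0) {a : ℕ → ℕ} (ha : StrictMono a) {α : ℝ}
    (hα : 0 < α) (hlim : Tendsto (fun n : ℕ => (a n : ℝ) / (α * (n : ℝ) ^ h)) atTop (𝓝 1)) :
    HasRootCount h (Set.range a) (α ^ (h : ℝ)⁻¹)⁻¹ := by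
  set c := countBelow (Set.range a) with hc
  have hca : ∀ n, c (a n) = n := countBelow_range ha
  have hcmono : Monotone c := countBelow_mono _
  have hctop : Tendsto c atTop atTop :=
    tendsto_atTop_atTop.2 fun b => ⟨a b, fun x hx => (hca b).symm.le.trans (hcmono hx)⟩
  have hup : ∀ x, x ≤ a (c x) := by
    intro x
    by_contra! hlt
    have h1 : c (a (c x) + 1) ≤ c x := hcmono hlt
    rw [hc, countBelow_succ, if_pos ⟨_, rfl⟩, ← hc, hca] at h1
    omega
  have hlow : ∀ x m, m < c x → a m < x := by
    intro x m hm
    by_contra! hle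
    have := hcmono hle
    rw [hca] at this
    omega
  have hu : Tendsto (fun n : ℕ => (a n : ℝ) / (n : ℝ) ^ h) atTop (𝓝 α) := by
    have := hlim.const_mul α
    rw [mul_one] at this
    refine this.congr fun n => ?_
    field_simp
  have hu' : Tendsto (fun n : ℕ => (a (n - 1) : ℝ) / (n : ℝ) ^ h) atTop (𝓝 α) := by
    rw [← tendsto_add_atTop_iff_nat 1]
    have h1 : Tendsto (fun n : ℕ => ((n : ℝ) / ((n : ℝ) + 1)) ^ h) atTop (𝓝 (1 ^ h)) :=
      (tendsto_natCast_div_add_atTop (1 : ℝ)).pow h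
    have h2 := hu.mul h1
    rw [one_pow, mul_one] at h2
    refine h2.congr' ?_
    filter_upwards [eventually_gt_atTop 0] with n hn
    have : (0 : ℝ) < n := by exact_mod_cast hn
    simp only [Nat.add_sub_cancel]
    push_cast
    rw [div_pow]
    field_simp
  have hx : Tendsto (fun x : ℕ => (x : ℝ) / (c x : ℝ) ^ h) atTop (𝓝 α) := by
    refine tendsto_of_tendsto_of_tendsto_of_le_of_le' (hu'.comp hctop) (hu.comp hctop) ?_ ?_
    · filter_upwards [hctop.eventually_gt_atTop 0] with x hx
      have := (hlow x (c x - 1) (by omega)).le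
      simp only [Function.comp]
      gcongr
    · filter_upwards with x
      have := hup x
      simp only [Function.comp]
      gcongr
  have h3 := ((hx.rpow_const (p := (h : ℝ)⁻¹) (Or.inl hα.ne')).inv₀ (by positivity))
  refine h3.congr fun x => ?_
  rw [Real.div_rpow (by positivity) (by positivity), Real.pow_rpow_inv_natCast (by positivity) hh,
    inv_div]

lemma HasRootCount.exists_strictMono {h : ℕ} (hh : h ≠ 0) {A : Set ℕ} {α : ℝ} (hα : 0 < α)
    (hA : HasRootCount h A (α ^ (h : ℝ)⁻¹)⁻¹) :
    ∃ a : ℕ → ℕ, StrictMono a ∧ Set.range a = A ∧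
      Tendsto (fun n : ℕ => (a n : ℝ) / (α * (n : ℝ) ^ h)) atTop (𝓝 1) := by
  classical
  have hinf : A.Infinite := by
    intro hfin
    have hle : ∀ x, countBelow A x ≤ hfin.toFinset.card := fun x => by
      rw [countBelow_eq_card]
      exact Finset.card_le_card fun y hy => by simpa using (Finset.mem_filter.1 hy).2
    have h0 : Tendsto (fun x : ℕ => (countBelow A x : ℝ) / (x : ℝ) ^ (h : ℝ)⁻¹) atTop (𝓝 0) :=
      squeeze_zero (fun x => by positivity)
        (fun x => div_le_div_of_nonneg_right (Nat.cast_le.2 (hle x)) (by positivity))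
        ((tendsto_natCast_rpow_inv hh).const_div_atTop _)
    have := tendsto_nhds_unique h0 hA
    have : (0 : ℝ) < (α ^ (h : ℝ)⁻¹)⁻¹ := by positivity
    linarith
  have hmono : StrictMono (Nat.nth (· ∈ A)) := Nat.nth_strictMono hinf
  refine ⟨Nat.nth (· ∈ A), hmono, Nat.range_nth_of_infinite hinf, ?_⟩
  have hc : ∀ n, countBelow A (Nat.nth (· ∈ A) n) = n := Nat.count_nth_of_infinite hinf
  have h1 := ((hA.comp hmono.tendsto_atTop).inv₀ (by positivity)).pow h
  rw [inv_inv, Real.rpow_inv_natCast_pow hα.le hh] at h1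
  have h2 := h1.const_mul α⁻¹
  rw [inv_mul_cancel₀ hα.ne'] at h2
  refine h2.congr fun n => ?_
  simp only [Function.comp]
  rw [hc, inv_div, div_pow, Real.rpow_inv_natCast_pow (by positivity) hh]
  field_simp

lemma isAdditiveEigenvalue_iff {h : ℕ} (hh : h ≠ 0) {α : ℝ} :
    IsAdditiveEigenvalue h α ↔
      0 < α ∧ ∃ A : Set ℕ, IsAsymptoticBasis h A ∧ HasRootCount h A (α ^ (h : ℝ)⁻¹)⁻¹ := by
  constructor
  · rintro ⟨a, ha, hb, hlim⟩
    have hα : 0 < α := by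
      by_contra! hle
      have : (1 : ℝ) ≤ 0 := le_of_tendsto' hlim fun n =>
        div_nonpos_of_nonneg_of_nonpos (by positivity)
          (mul_nonpos_of_nonpos_of_nonneg hle (by positivity))
      linarith
    exact ⟨hα, Set.range a, hb, .of_tendsto hh ha hα hlim⟩
  · rintro ⟨hα, A, hb, hA⟩
    obtain ⟨a, ha, rfl, hlim⟩ := hA.exists_strictMono hh hα
    exact ⟨a, ha, hb, hlim⟩

/-- Counting multisets of size `h` of elements below `x`. -/
lemma IsAsymptoticBasis.le_choose {h : ℕ} {A : Set ℕ} (hA : IsAsymptoticBasis h A) :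
    ∃ n₀ : ℕ, ∀ x, x - n₀ ≤ (countBelow A x + h - 1).choose h := by
  classical
  obtain ⟨n₀, H⟩ := hA
  refine ⟨n₀, fun x => ?_⟩
  set S := (Finset.range x).filter (· ∈ A) with hS
  have hsub : Finset.Ico n₀ x ⊆ (Finset.univ : Finset (Sym S h)).image
      (fun m => (m.1.map Subtype.val).sum) := by
    intro n hn
    rw [Finset.mem_Ico] at hn
    obtain ⟨c, hc, hs⟩ := H n hn.1
    have hcS : ∀ i, c i ∈ S := fun i => by
      rw [hS, Finset.mem_filter, Finset.mem_range]
      exact ⟨(Finset.single_le_sum (fun _ _ => Nat.zero_le _) (Finset.mem_univ i)).trans_lt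
        (hs.trans_lt hn.2), hc i⟩
    refine Finset.mem_image.2 ⟨⟨Finset.univ.val.map fun i => ⟨c i, hcS i⟩, by simp⟩,
      Finset.mem_univ _, ?_⟩
    simpa [List.sum_ofFn] using hs
  have := (Finset.card_le_card hsub).trans Finset.card_image_le
  rwa [Nat.card_Ico, Finset.card_univ, Sym.card_sym_eq_choose, Fintype.card_coe,
    ← countBelow_eq_card] at this

lemma le_one_div_factorial {h : ℕ} (hh : h ≠ 0) {α : ℝ} (hα : 0 < α) {A : Set ℕ}
    (hA : IsAsymptoticBasis h A) (hc : HasRootCount h A (α ^ (h : ℝ)⁻¹)⁻¹) :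
    α ≤ 1 / h.factorial := by
  obtain ⟨n₀, H⟩ := hA.le_choose
  have hbd : ∀ x : ℕ, (x : ℝ) - n₀ ≤ ((countBelow A x : ℝ) + h) ^ h / h.factorial := by
    intro x
    have h1 : ((x - n₀ : ℕ) : ℝ) ≤ ((countBelow A x + h - 1).choose h : ℕ) := by
      exact_mod_cast H x
    have h2 : (x : ℝ) - n₀ ≤ ((x - n₀ : ℕ) : ℝ) := by
      rw [sub_le_iff_le_add]
      exact_mod_cast (by omega : x ≤ x - n₀ + n₀)
    have h3 := Nat.choose_le_pow_div (α := ℝ) h (countBelow A x + h - 1)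
    refine h2.trans (h1.trans (h3.trans ?_))
    gcongr
    exact_mod_cast Nat.sub_le _ _
  have hφ := tendsto_natCast_rpow_inv hh
  have hl : Tendsto (fun x : ℕ => 1 - (n₀ : ℝ) / x) atTop (𝓝 (1 - 0)) :=
    tendsto_const_nhds.sub (tendsto_const_div_atTop_nhds_zero_nat _)
  have hr := ((hc.add (hφ.const_div_atTop (h : ℝ))).pow h).div_const (h.factorial : ℝ)
  have hle := le_of_tendsto_of_tendsto hl hr (by
    filter_upwards [eventually_gt_atTop 0] with x hx
    have hx' : (0 : ℝ) < x := by exact_mod_cast hx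
    have := div_le_div_of_nonneg_right (hbd x) hx'.le
    rw [← add_div, div_pow, Real.rpow_inv_natCast_pow hx'.le hh, div_right_comm]
    rwa [sub_div, div_self hx'.ne'] at this)
  rw [add_zero, sub_zero, inv_pow, Real.rpow_inv_natCast_pow hα.le hh,
    le_div_iff₀ (by positivity), one_mul] at hle
  rw [le_div_iff₀ (by positivity)]
  calc α * h.factorial ≤ α * α⁻¹ := by gcongr
    _ = 1 := mul_inv_cancel₀ hα.ne'

open scoped Classical in
/-- The counting function of the set obtained from `A` by adjoining, greedily, each integer at
which the count would otherwise fall below `g`. -/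
noncomputable def greedyCount (A : Set ℕ) (g : ℕ → ℕ) : ℕ → ℕ
  | 0 => 0
  | x + 1 => greedyCount A g x + if x ∈ A ∨ greedyCount A g x < g (x + 1) then 1 else 0

/-- The set obtained from `A` by adjoining, greedily, each integer at which the count would
otherwise fall below `g`. -/
def greedySet (A : Set ℕ) (g : ℕ → ℕ) : Set ℕ := {x | x ∈ A ∨ greedyCount A g x < g (x + 1)}

lemma subset_greedySet (A : Set ℕ) (g : ℕ → ℕ) : A ⊆ greedySet A g := fun _ hx => Or.inl hx

lemma countBelow_greedySet (A : Set ℕ) (g : ℕ → ℕ) (x : ℕ) :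
    countBelow (greedySet A g) x = greedyCount A g x := by
  induction x with
  | zero => rw [countBelow_zero, greedyCount]
  | succ x ih =>
    rw [countBelow_succ, ih, greedyCount]
    congr

lemma le_greedyCount (A : Set ℕ) {g : ℕ → ℕ} (h0 : g 0 = 0) (hg : ∀ x, g (x + 1) ≤ g x + 1)
    (x : ℕ) : g x ≤ greedyCount A g x := by
  induction x with
  | zero => simp [h0]
  | succ x ih =>
    have := hg x
    rw [greedyCount]
    split_ifs with hx
    · omega
    · have := not_or.1 hx
      omega

lemma exists_greedyCount_le (A : Set ℕ) (g : ℕ → ℕ) (x : ℕ) :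
    ∃ y ≤ x, greedyCount A g x + countBelow A y ≤ g y + countBelow A x := by
  induction x with
  | zero => exact ⟨0, le_rfl, by simp [greedyCount]⟩
  | succ x ih =>
    obtain ⟨y, hy, hle⟩ := ih
    by_cases hlt : greedyCount A g x < g (x + 1)
    · refine ⟨x + 1, le_rfl, ?_⟩
      rw [greedyCount, if_pos (Or.inr hlt)]
      omega
    · refine ⟨y, by omega, ?_⟩
      rw [greedyCount, countBelow_succ]
      by_cases hx : x ∈ A
      · simp only [hx, true_or, if_true]
        omega
      · simp only [hx, hlt, or_self, if_false]
        omega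

lemma add_one_rpow_inv_le {h : ℕ} (hh : 1 ≤ h) {x : ℝ} (hx : 0 < x) :
    (x + 1) ^ (h : ℝ)⁻¹ ≤ x ^ (h : ℝ)⁻¹ + x ^ ((h : ℝ)⁻¹ - 1) := by
  have hp : (h : ℝ)⁻¹ ≤ 1 := inv_le_one_of_one_le₀ (by exact_mod_cast hh)
  have h1 := rpow_one_add_le_one_add_mul_self (s := x⁻¹)
    (by linarith [inv_pos.2 hx]) (p := (h : ℝ)⁻¹) (by positivity) hp
  have h2 : x + 1 = x * (1 + x⁻¹) := by field_simp
  rw [h2, Real.mul_rpow hx.le (by positivity), Real.rpow_sub_one hx.ne']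
  calc x ^ (h : ℝ)⁻¹ * (1 + x⁻¹) ^ (h : ℝ)⁻¹
      ≤ x ^ (h : ℝ)⁻¹ * (1 + 1 * x⁻¹) := by
        gcongr
        exact h1.trans (by gcongr)
    _ = _ := by ring

/-- If the local counts of `A` do not asymptotically exceed those of `γ x ^ (1 / h)`, then `A`
has a superset whose counting function is asymptotic to `γ x ^ (1 / h)`. -/
lemma exists_superset_hasRootCount {h : ℕ} (hh : 2 ≤ h) {A : Set ℕ} {γ : ℝ} (hγ : 0 < γ)
    (H : ∀ ε > 0, ∀ᶠ x : ℕ in atTop, ∀ y ≤ x, (countBelow A x : ℝ) - countBelow A y ≤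
      γ * ((x : ℝ) ^ (h : ℝ)⁻¹ - (y : ℝ) ^ (h : ℝ)⁻¹) + ε * (x : ℝ) ^ (h : ℝ)⁻¹) :
    ∃ B, A ⊆ B ∧ HasRootCount h B γ := by
  have hh0 : h ≠ 0 := by omega
  set φ : ℕ → ℝ := fun x => (x : ℝ) ^ (h : ℝ)⁻¹ with hφ
  have hφ0 : ∀ x, 0 ≤ φ x := fun x => by positivity
  have hφmono : Monotone φ := fun x y hxy => by
    simp only [hφ]
    gcongr
  have hφtop : Tendsto φ atTop atTop := tendsto_natCast_rpow_inv hh0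
  have hstep : ∀ᶠ x : ℕ in atTop, γ * φ (x + 1) ≤ γ * φ x + 1 := by
    have hneg : 0 < 1 - (h : ℝ)⁻¹ := by
      have : (h : ℝ)⁻¹ < 1 := inv_lt_one_of_one_lt₀ (by exact_mod_cast hh)
      linarith
    have h1 := ((tendsto_rpow_neg_atTop hneg).comp tendsto_natCast_atTop_atTop).const_mul γ
    rw [mul_zero] at h1
    filter_upwards [h1.eventually_le_const one_pos, eventually_gt_atTop 0] with x hx hx0
    have h2 := add_one_rpow_inv_le (h := h) (by omega) (x := x) (by exact_mod_cast hx0)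
    simp only [Function.comp, neg_sub] at hx
    simp only [hφ]
    push_cast
    nlinarith
  obtain ⟨x₀, hx₀⟩ := eventually_atTop.1 hstep
  set K := ⌊γ * φ x₀⌋₊ with hK
  set g : ℕ → ℕ := fun x => ⌊γ * φ x⌋₊ - K with hg
  have hg0 : g 0 = 0 := by
    simp [hg, hφ, Real.zero_rpow (inv_ne_zero (Nat.cast_ne_zero.2 hh0))]
  have hgs : ∀ x, g (x + 1) ≤ g x + 1 := by
    intro x
    rcases le_or_gt x₀ x with hx | hx
    · have h1 : ⌊γ * φ (x + 1)⌋₊ ≤ ⌊γ * φ x⌋₊ + 1 := by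
        rw [← Nat.floor_add_one (by have := hφ0 x; positivity)]
        exact Nat.floor_mono (hx₀ x hx)
      simp only [hg]
      omega
    · have h1 : ⌊γ * φ (x + 1)⌋₊ ≤ K :=
        Nat.floor_mono (mul_le_mul_of_nonneg_left (hφmono hx) hγ.le)
      simp only [hg]
      omega
  refine ⟨greedySet A g, subset_greedySet A g, ?_⟩
  have hlow : ∀ x, γ * φ x - (K + 1) ≤ greedyCount A g x := by
    intro x
    have h1 : (g x : ℝ) ≤ greedyCount A g x := by exact_mod_cast le_greedyCount A hg0 hgs x
    have h2 : ((⌊γ * φ x⌋₊ : ℕ) : ℝ) ≤ g x + K := by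
      exact_mod_cast (by simp only [hg]; omega : ⌊γ * φ x⌋₊ ≤ g x + K)
    linarith [Nat.lt_floor_add_one (γ * φ x)]
  have hup : ∀ ε > 0, ∀ᶠ x : ℕ in atTop, (greedyCount A g x : ℝ) ≤ (γ + ε) * φ x := by
    intro ε hε
    filter_upwards [H ε hε] with x hx
    obtain ⟨y, hyx, hy⟩ := exists_greedyCount_le A g x
    have h1 : (greedyCount A g x : ℝ) + countBelow A y ≤ g y + countBelow A x := by
      exact_mod_cast hy
    have h2 : (g y : ℝ) ≤ γ * φ y :=
      (Nat.cast_le.2 (Nat.sub_le _ _)).trans (Nat.floor_le (by have := hφ0 y; positivity))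
    have h3 := hx y hyx
    simp only [hφ] at *
    linarith
  simp only [HasRootCount, countBelow_greedySet]
  rw [tendsto_order]
  constructor
  · intro b hb
    have h1 : Tendsto (fun x => γ - (K + 1) / φ x) atTop (𝓝 (γ - 0)) :=
      tendsto_const_nhds.sub (hφtop.const_div_atTop _)
    rw [sub_zero] at h1
    filter_upwards [h1.eventually_const_lt hb, hφtop.eventually_gt_atTop 0] with x hx hpos
    refine hx.trans_le ?_
    rw [le_div_iff₀ hpos, sub_mul, div_mul_cancel₀ _ hpos.ne']
    exact hlow x
  · intro b hb
    filter_upwards [hup ((b - γ) / 2) (by linarith), hφtop.eventually_gt_atTop 0] with x hx hpos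
    rw [div_lt_iff₀ hpos]
    refine hx.trans_lt ?_
    gcongr
    linarith

/-- Enlarging a set multiplies its counting function asymptotically by any larger constant. -/
lemma HasRootCount.exists_superset {h : ℕ} (hh : 2 ≤ h) {A : Set ℕ} {γ₀ γ : ℝ} (h0 : 0 < γ₀)
    (hlt : γ₀ < γ) (hA : HasRootCount h A γ₀) : ∃ B, A ⊆ B ∧ HasRootCount h B γ := by
  refine exists_superset_hasRootCount hh (h0.trans hlt) fun ε hε => ?_
  set φ : ℕ → ℝ := fun x => (x : ℝ) ^ (h : ℝ)⁻¹ with hφ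
  have hφ0 : ∀ x, 0 ≤ φ x := fun x => by positivity
  have hφmono : Monotone φ := fun x y hxy => by
    simp only [hφ]
    gcongr
  have hφtop : Tendsto φ atTop atTop := tendsto_natCast_rpow_inv (by omega)
  have hev : ∀ᶠ x : ℕ in atTop, (γ₀ - ε / 4) * φ x ≤ countBelow A x ∧
      (countBelow A x : ℝ) ≤ (γ₀ + ε / 4) * φ x := by
    filter_upwards [hA.eventually_const_le (show γ₀ - ε / 4 < γ₀ by linarith),
      hA.eventually_le_const (show γ₀ < γ₀ + ε / 4 by linarith),
      hφtop.eventually_gt_atTop 0] with x h1 h2 hpos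
    exact ⟨(le_div_iff₀ hpos).1 h1, (div_le_iff₀ hpos).1 h2⟩
  obtain ⟨x₁, hx₁⟩ := eventually_atTop.1 hev
  filter_upwards [eventually_ge_atTop x₁,
    (hφtop.const_mul_atTop (by positivity : 0 < ε / 4)).eventually_ge_atTop (γ₀ * φ x₁)]
    with x hx hbig y hyx
  have hm := hφmono hyx
  have h1 := (hx₁ x hx).2
  change _ ≤ γ * (φ x - φ y) + ε * φ x
  have h3 : γ₀ * (φ x - φ y) ≤ γ * (φ x - φ y) :=
    mul_le_mul_of_nonneg_right hlt.le (by linarith)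
  rcases le_or_gt x₁ y with hy | hy
  · have h2 := (hx₁ y hy).1
    nlinarith [hφ0 x, hφ0 y]
  · have h2 : (0 : ℝ) ≤ countBelow A y := by positivity
    have h4 : γ₀ * φ y ≤ γ₀ * φ x₁ := mul_le_mul_of_nonneg_left (hφmono hy.le) h0.le
    nlinarith [hφ0 x, hφ0 y]

/-- A set with boundedly many elements between consecutive `h`-th powers is contained in a set
whose counting function is asymptotic to a multiple of `x ^ (1 / h)`. -/
lemma exists_superset_of_window_bound {h : ℕ} (hh : 2 ≤ h) {A : Set ℕ} {C : ℕ} (hC : 0 < C)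
    (hA : ∀ n, ∀ S : Finset ℕ, (∀ z ∈ S, z ∈ A ∧ n ^ h ≤ z ∧ z < (n + 1) ^ h) → S.card ≤ C) :
    ∃ B, A ⊆ B ∧ HasRootCount h B C := by
  classical
  have hh0 : h ≠ 0 := by omega
  have hCr : (0 : ℝ) < C := by exact_mod_cast hC
  refine exists_superset_hasRootCount hh hCr fun ε hε => ?_
  set φ : ℕ → ℝ := fun x => (x : ℝ) ^ (h : ℝ)⁻¹ with hφ
  have hφ0 : ∀ x, 0 ≤ φ x := fun x => by positivity
  have hφmono : Monotone φ := fun x y hxy => by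
    simp only [hφ]
    gcongr
  have hφh : ∀ x, φ x ^ h = x := fun x => Real.rpow_inv_natCast_pow (by positivity) hh0
  have hφtop : Tendsto φ atTop atTop := tendsto_natCast_rpow_inv hh0
  filter_upwards [(hφtop.const_mul_atTop hε).eventually_ge_atTop (2 * C : ℝ)] with x hbig y hyx
  have hcard : countBelow A x ≤ countBelow A y + (⌊φ x⌋₊ + 1 - ⌊φ y⌋₊) * C := by
    rw [countBelow_eq_card, countBelow_eq_card]
    have hsub : (Finset.range x).filter (· ∈ A) ⊆ (Finset.range y).filter (· ∈ A) ∪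
        (Finset.Ico ⌊φ y⌋₊ (⌊φ x⌋₊ + 1)).biUnion
          (fun n => (Finset.Ico (n ^ h) ((n + 1) ^ h)).filter (· ∈ A)) := by
      intro z hz
      rw [Finset.mem_filter, Finset.mem_range] at hz
      rw [Finset.mem_union]
      by_cases hzy : z < y
      · left
        simp [hzy, hz.2]
      · right
        push Not at hzy
        refine Finset.mem_biUnion.2 ⟨⌊φ z⌋₊, ?_, ?_⟩
        · have h1 := Nat.floor_mono (hφmono hzy)
          have h2 := Nat.floor_mono (hφmono hz.1.le)
          rw [Finset.mem_Ico]
          omega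
        · rw [Finset.mem_filter, Finset.mem_Ico]
          refine ⟨⟨?_, ?_⟩, hz.2⟩
          · have : ((⌊φ z⌋₊ : ℝ)) ^ h ≤ z := by
              rw [← hφh z]
              exact pow_le_pow_left₀ (by positivity) (Nat.floor_le (hφ0 z)) h
            exact_mod_cast this
          · have : (z : ℝ) < ((⌊φ z⌋₊ : ℝ) + 1) ^ h := by
              rw [← hφh z]
              exact pow_lt_pow_left₀ (Nat.lt_floor_add_one _) (hφ0 z) hh0
            exact_mod_cast this
    refine (Finset.card_le_card hsub).trans ((Finset.card_union_le _ _).trans ?_)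
    gcongr
    refine (Finset.card_biUnion_le_card_mul _ _ C fun n _ => hA n _ fun z hz => ?_).trans ?_
    · rw [Finset.mem_filter, Finset.mem_Ico] at hz
      exact ⟨hz.2, hz.1⟩
    · rw [Nat.card_Ico]
  have hfl : ⌊φ y⌋₊ ≤ ⌊φ x⌋₊ + 1 := (Nat.floor_mono (hφmono hyx)).trans (Nat.le_succ _)
  have h1 : (countBelow A x : ℝ) ≤ countBelow A y + ((⌊φ x⌋₊ : ℝ) + 1 - ⌊φ y⌋₊) * C := by
    have : (countBelow A x : ℝ) ≤ ((countBelow A y + (⌊φ x⌋₊ + 1 - ⌊φ y⌋₊) * C : ℕ) : ℝ) := by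
      exact_mod_cast hcard
    rw [Nat.cast_add, Nat.cast_mul, Nat.cast_sub hfl] at this
    push_cast at this
    exact this
  have h2 := Nat.floor_le (hφ0 x)
  have h3 := Nat.lt_floor_add_one (φ y)
  change _ ≤ (C : ℝ) * (φ x - φ y) + ε * φ x
  nlinarith

end CountingFunction

section ThinBasis

/-- Every large integer is a sum of large multiples of the cofactors of pairwise coprime moduli. -/
lemma exists_sum_multiples {h : ℕ} [NeZero h] {p : Fin h → ℕ} (hp : ∀ i, 0 < p i)
    (hcop : Pairwise (Function.onFun Nat.Coprime p)) {n : ℕ} (hn : 2 * h * ∏ i, p i ≤ n) :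
    ∃ z : Fin h → ℕ, (∀ i, ∏ k ∈ {i}ᶜ, p k ∣ z i ∧ ∏ k, p k ≤ z i ∧ z i ≤ n) ∧
      ∑ i, z i = n := by
  set D : Fin h → ℤ := fun i => ∏ k ∈ {i}ᶜ, (p k : ℤ) with hD
  set M : ℤ := ∏ k, (p k : ℤ) with hM
  have hDpos : ∀ i, 0 < D i := fun i => Finset.prod_pos fun k _ => by exact_mod_cast hp k
  have hMpos : 0 < M := Finset.prod_pos fun k _ => by exact_mod_cast hp k
  have hpD : ∀ i, (p i : ℤ) * D i = M := fun i =>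
    Fintype.prod_eq_mul_prod_compl i (fun k => (p k : ℤ)) |>.symm
  obtain ⟨μ, hμ⟩ := (exists_sum_eq_one_iff_pairwise_coprime' (R := ℤ) (s := fun i => (p i : ℤ))).2
    fun i j hij => Nat.isCoprime_iff_coprime.2 (hcop hij)
  set s : Fin h → ℤ := fun i => (n * μ i) % p i with hs
  have hs0 : ∀ i, 0 ≤ s i := fun i => Int.emod_nonneg _ (by exact_mod_cast (hp i).ne')
  have hsp : ∀ i, s i < p i := fun i => Int.emod_lt_of_pos _ (by exact_mod_cast hp i)
  set R : ℤ := n - ∑ i, (s i + p i) * D i with hR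
  have hMR : M ∣ R := by
    have h1 : (n : ℤ) = ∑ i, (n * μ i) * D i := by
      calc (n : ℤ) = n * ∑ i, μ i * D i := by rw [hμ, mul_one]
        _ = _ := by rw [Finset.mul_sum]; exact Finset.sum_congr rfl fun i _ => by ring
    have h2 : R = ∑ i, ((n * μ i) / p i - 1) * M := by
      rw [hR]
      conv_lhs => rw [h1]
      rw [← Finset.sum_sub_distrib]
      refine Finset.sum_congr rfl fun i _ => ?_
      have := Int.emod_add_mul_ediv (n * μ i) (p i)
      rw [← hpD i]
      simp only [hs]
      linear_combination (- D i) * this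
    rw [h2]
    exact Finset.dvd_sum fun i _ => Dvd.intro_left _ rfl
  have hR0 : 0 ≤ R := by
    have h1 : ∑ i, (s i + p i) * D i ≤ ∑ i : Fin h, 2 * M := by
      refine Finset.sum_le_sum fun i _ => ?_
      rw [← hpD i, ← mul_assoc]
      exact mul_le_mul_of_nonneg_right (by linarith [hsp i]) (hDpos i).le
    have h2 : (2 * h * M : ℤ) ≤ n := by rw [hM]; exact_mod_cast hn
    rw [Finset.sum_const, Finset.card_univ, Fintype.card_fin, nsmul_eq_mul] at h1
    linarith
  obtain ⟨z, hz⟩ : ∃ z : Fin h → ℤ, z = fun i => (s i + p i) * D i + if i = 0 then R else 0 :=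
    ⟨_, rfl⟩
  have hzM : ∀ i, M ≤ z i := fun i => by
    have h1 : (0 : ℤ) ≤ if i = 0 then R else 0 := by split_ifs <;> simp [hR0]
    have h2 := mul_nonneg (hs0 i) (hDpos i).le
    have h3 := hpD i
    rw [hz]
    linarith
  have hzD : ∀ i, D i ∣ z i := fun i => by
    rw [hz]
    refine dvd_add (Dvd.intro_left _ rfl) ?_
    split_ifs
    · exact (Dvd.intro_left _ (hpD i)).trans hMR
    · exact dvd_zero _
  have hsum : ∑ i, z i = n := by
    rw [hz, Finset.sum_add_distrib, Finset.sum_ite_eq']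
    simp [hR]
  lift z to Fin h → ℕ using fun i => hMpos.le.trans (hzM i)
  beta_reduce at hzM hzD hsum
  have hsum' : ∑ i, z i = n := by exact_mod_cast hsum
  refine ⟨z, fun i => ⟨?_, ?_, ?_⟩, hsum'⟩
  · have := hzD i
    simp only [hD] at this
    exact_mod_cast this
  · have := hzM i
    rw [hM] at this
    exact_mod_cast this
  · rw [← hsum']
    exact Finset.single_le_sum (fun _ _ => Nat.zero_le _) (Finset.mem_univ i)

/-- Pairwise coprime moduli of size comparable to `2 ^ j`. -/
def modulus (h j : ℕ) (i : Fin h) : ℕ := (i + 1) * (h.factorial * 2 ^ j) + 1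

/-- The product of the moduli at scale `j`. -/
def modulusProd (h j : ℕ) : ℕ := ∏ i, modulus h j i

/-- The product of all moduli at scale `j` but the `i`-th. -/
def cofactor (h j : ℕ) (i : Fin h) : ℕ := ∏ k ∈ {i}ᶜ, modulus h j k

/-- The multiples, at each scale, of each cofactor that are comparable to the product of the
moduli. -/
def thinBasis (h : ℕ) : Set ℕ :=
  {z | ∃ j, ∃ i : Fin h, cofactor h j i ∣ z ∧ modulusProd h j ≤ z ∧
    z ≤ h * 2 ^ (h + 1) * modulusProd h j}

lemma pairwise_coprime_modulus (h j : ℕ) :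
    Pairwise (Function.onFun Nat.Coprime (modulus h j)) := by
  have key : ∀ i k : Fin h, i < k → Nat.Coprime (modulus h j i) (modulus h j k) := by
    intro i k hik
    refine Nat.coprime_mul_succ (Dvd.dvd.mul_right (Nat.dvd_factorial ?_ ?_) _)
    · have : (i : ℕ) < k := hik
      omega
    · omega
  intro i k hik
  rcases lt_or_gt_of_ne hik with hlt | hlt
  · exact key i k hlt
  · exact (key k i hlt).symm

lemma le_modulus (h j : ℕ) (i : Fin h) : h.factorial * 2 ^ j ≤ modulus h j i := by
  rw [modulus]
  nlinarith [Nat.zero_le ((i : ℕ) * (h.factorial * 2 ^ j))]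

lemma modulus_le (h j : ℕ) (i : Fin h) : modulus h j i ≤ (h + 1) * (h.factorial * 2 ^ j) := by
  have h1 : 0 < h.factorial * 2 ^ j := by positivity
  have h2 : ((i : ℕ) + 1) * (h.factorial * 2 ^ j) ≤ h * (h.factorial * 2 ^ j) :=
    Nat.mul_le_mul_right _ i.2
  rw [modulus, add_mul h]
  omega

lemma pow_le_modulusProd (h j : ℕ) : (h.factorial * 2 ^ j) ^ h ≤ modulusProd h j := by
  have := Finset.prod_le_prod' (s := (Finset.univ : Finset (Fin h)))
    fun i _ => le_modulus h j i
  simpa [modulusProd] using this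

lemma modulusProd_le (h j : ℕ) : modulusProd h j ≤ ((h + 1) * (h.factorial * 2 ^ j)) ^ h := by
  have := Finset.prod_le_prod' (s := (Finset.univ : Finset (Fin h)))
    fun i _ => modulus_le h j i
  simpa only [modulusProd, Finset.prod_const, Finset.card_univ, Fintype.card_fin] using this

lemma pow_le_cofactor (h j : ℕ) (i : Fin h) :
    (h.factorial * 2 ^ j) ^ (h - 1) ≤ cofactor h j i := by
  have := Finset.prod_le_prod' (s := ({i}ᶜ : Finset (Fin h)))
    fun i _ => le_modulus h j i
  simpa only [cofactor, Finset.prod_const, Finset.card_compl, Finset.card_singleton,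
    Fintype.card_fin] using this

lemma modulusProd_succ_le (h j : ℕ) : modulusProd h (j + 1) ≤ 2 ^ h * modulusProd h j := by
  have : ∏ i, modulus h (j + 1) i ≤ ∏ i, 2 * modulus h j i := by
    refine Finset.prod_le_prod' fun i _ => ?_
    rw [modulus, modulus, pow_succ]
    nlinarith
  simpa [Finset.prod_mul_distrib, modulusProd] using this

lemma isAsymptoticBasis_thinBasis {h : ℕ} (hh : h ≠ 0) : IsAsymptoticBasis h (thinBasis h) := by
  have : NeZero h := ⟨hh⟩
  refine ⟨2 * h * modulusProd h 0, fun n hn => ?_⟩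
  obtain ⟨j, hj1, hj2⟩ : ∃ j, 2 * h * modulusProd h j ≤ n ∧ n < 2 * h * modulusProd h (j + 1) := by
    by_contra! hcon
    have hall : ∀ j, 2 * h * modulusProd h j ≤ n := fun j => by
      induction j with
      | zero => exact hn
      | succ j ih => exact hcon j ih
    have h1 : n < 2 ^ n := Nat.lt_two_pow_self
    have h2 : 2 ^ n ≤ h.factorial * 2 ^ n := Nat.le_mul_of_pos_left _ h.factorial_pos
    have h3 := Nat.le_self_pow hh (h.factorial * 2 ^ n)
    have h4 := pow_le_modulusProd h n
    have h5 : modulusProd h n ≤ 2 * h * modulusProd h n :=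
      Nat.le_mul_of_pos_left _ (by positivity)
    have h6 := hall n
    omega
  obtain ⟨z, hz, hsum⟩ := exists_sum_multiples (p := modulus h j)
    (fun i => Nat.succ_pos _) (pairwise_coprime_modulus h j) hj1
  refine ⟨z, fun i => ⟨j, i, (hz i).1, (hz i).2.1, (hz i).2.2.trans (hj2.le.trans ?_)⟩, hsum⟩
  calc 2 * h * modulusProd h (j + 1) ≤ 2 * h * (2 ^ h * modulusProd h j) := by
        gcongr
        exact modulusProd_succ_le h j
    _ = h * 2 ^ (h + 1) * modulusProd h j := by ring

lemma succ_pow_le (n k : ℕ) : (n + 1) ^ (k + 1) ≤ n ^ (k + 1) + (k + 1) * (n + 1) ^ k := by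
  induction k with
  | zero => simp
  | succ k ih =>
    calc (n + 1) ^ (k + 1 + 1) = (n + 1) ^ (k + 1) * n + (n + 1) ^ (k + 1) := by ring
      _ ≤ (n ^ (k + 1) + (k + 1) * (n + 1) ^ k) * n + (n + 1) ^ (k + 1) := by gcongr
      _ = n ^ (k + 1 + 1) + (k + 1) * ((n + 1) ^ k * n) + (n + 1) ^ (k + 1) := by ring
      _ ≤ n ^ (k + 1 + 1) + (k + 1) * ((n + 1) ^ k * (n + 1)) + (n + 1) ^ (k + 1) := by
        gcongr
        omega
      _ = _ := by ring

lemma card_le_of_forall_dvd {S : Finset ℕ} {d a b K : ℕ} (hd : 0 < d) (hab : b ≤ a + K * d)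
    (hS : ∀ z ∈ S, d ∣ z ∧ a ≤ z ∧ z < b) : S.card ≤ K + 1 := by
  have h1 : S.card ≤ (Finset.Icc (a / d) (a / d + K)).card := by
    refine Finset.card_le_card_of_injOn (· / d) (fun z hz => ?_) fun z hz w hw hzw => ?_
    · obtain ⟨-, h2, h3⟩ := hS z hz
      rw [Finset.mem_coe, Finset.mem_Icc]
      refine ⟨Nat.div_le_div_right h2, ?_⟩
      rw [← Nat.add_mul_div_right _ _ hd]
      exact Nat.div_le_div_right (h3.le.trans hab)
    · exact (Nat.div_left_inj (hS z hz).1 (hS w hw).1).1 hzw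
  rw [Nat.card_Icc] at h1
  omega

/-- At most `E` terms of the sequence `c 2 ^ j` lie between `n / E` and `n`. -/
lemma exists_scale_start {c E : ℕ} (hc : 0 < c) (n : ℕ) :
    ∃ j₀, ∀ j, c * 2 ^ j ≤ n → n ≤ E * (c * 2 ^ j) → j ∈ Finset.Ico j₀ (j₀ + E) := by
  classical
  by_cases hex : ∃ j, c * 2 ^ j ≤ n ∧ n ≤ E * (c * 2 ^ j)
  · refine ⟨Nat.find hex, fun j h1 h2 => ?_⟩
    obtain ⟨-, h3⟩ := Nat.find_spec hex
    have hmin := Nat.find_min' hex ⟨h1, h2⟩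
    set j₀ := Nat.find hex
    rw [Finset.mem_Ico]
    refine ⟨hmin, ?_⟩
    obtain ⟨m, rfl⟩ := Nat.exists_eq_add_of_le hmin
    have h4 : 2 ^ m * (c * 2 ^ j₀) ≤ E * (c * 2 ^ j₀) := by
      calc 2 ^ m * (c * 2 ^ j₀) = c * 2 ^ (j₀ + m) := by ring
        _ ≤ _ := h1.trans h3
    have h5 := Nat.le_of_mul_le_mul_right h4 (by positivity)
    have h6 : m < 2 ^ m := Nat.lt_two_pow_self
    omega
  · exact ⟨0, fun j h1 h2 => absurd ⟨j, h1, h2⟩ hex⟩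

lemma thinBasis_window_bound {h : ℕ} (hh : h ≠ 0) : ∃ C, 0 < C ∧ ∀ n, ∀ S : Finset ℕ,
    (∀ z ∈ S, z ∈ thinBasis h ∧ n ^ h ≤ z ∧ z < (n + 1) ^ h) → S.card ≤ C := by
  classical
  set E := h * 2 ^ (h + 1) * (h + 1) with hE
  set K := h * (2 * E) ^ (h - 1) with hK
  have hh0 : 0 < h := Nat.pos_of_ne_zero hh
  have hEpos : 0 < E := by positivity
  refine ⟨E * (h * (K + 1)), by positivity, fun n S hS => ?_⟩
  obtain ⟨j₀, hj₀⟩ := exists_scale_start (E := E) h.factorial_pos n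
  set P : ℕ → Fin h → Finset ℕ := fun j i => S.filter fun z => cofactor h j i ∣ z ∧
    modulusProd h j ≤ z ∧ z ≤ h * 2 ^ (h + 1) * modulusProd h j with hP
  have hrange : ∀ j i z, z ∈ P j i → h.factorial * 2 ^ j ≤ n ∧ n ≤ E * (h.factorial * 2 ^ j) := by
    intro j i z hz
    obtain ⟨hzS, -, h1, h2⟩ := Finset.mem_filter.1 hz
    obtain ⟨-, h3, h4⟩ := hS z hzS
    constructor
    · exact Nat.lt_succ_iff.1 (lt_of_pow_lt_pow_left₀ h (Nat.zero_le _)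
        (((pow_le_modulusProd h j).trans h1).trans_lt h4))
    · refine le_of_pow_le_pow_left₀ hh (Nat.zero_le _) (h3.trans (h2.trans ?_))
      calc h * 2 ^ (h + 1) * modulusProd h j
          ≤ (h * 2 ^ (h + 1)) ^ h * ((h + 1) * (h.factorial * 2 ^ j)) ^ h :=
            Nat.mul_le_mul (Nat.le_self_pow hh _) (modulusProd_le h j)
        _ = (E * (h.factorial * 2 ^ j)) ^ h := by rw [hE, ← mul_pow]; ring
  have hcard : ∀ j i, (P j i).card ≤ K + 1 := by
    intro j i
    rcases (P j i).eq_empty_or_nonempty with he | ⟨z₀, hz₀⟩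
    · simp [he]
    obtain ⟨-, hn2⟩ := hrange j i z₀ hz₀
    refine card_le_of_forall_dvd (d := cofactor h j i) (a := n ^ h) (b := (n + 1) ^ h)
      (Finset.prod_pos fun _ _ => Nat.succ_pos _) ?_ fun z hz => ?_
    · have h1 := succ_pow_le n (h - 1)
      rw [Nat.sub_add_cancel hh0] at h1
      refine h1.trans ?_
      rw [hK, mul_assoc]
      gcongr
      calc (n + 1) ^ (h - 1) ≤ (2 * E * (h.factorial * 2 ^ j)) ^ (h - 1) := by
            gcongr
            have : 0 < E * (h.factorial * 2 ^ j) := by positivity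
            rw [mul_assoc]
            omega
        _ = (2 * E) ^ (h - 1) * (h.factorial * 2 ^ j) ^ (h - 1) := mul_pow _ _ _
        _ ≤ _ := by
            gcongr
            exact pow_le_cofactor h j i
    · obtain ⟨hzS, h1, -, -⟩ := Finset.mem_filter.1 hz
      exact ⟨h1, (hS z hzS).2⟩
  have hsub : S ⊆ (Finset.Ico j₀ (j₀ + E)).biUnion fun j => Finset.univ.biUnion fun i => P j i := by
    intro z hz
    obtain ⟨j, i, hji⟩ := (hS z hz).1
    have hzP : z ∈ P j i := Finset.mem_filter.2 ⟨hz, hji⟩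
    obtain ⟨h1, h2⟩ := hrange j i z hzP
    exact Finset.mem_biUnion.2 ⟨j, hj₀ j h1 h2, Finset.mem_biUnion.2 ⟨i, Finset.mem_univ _, hzP⟩⟩
  refine (Finset.card_le_card hsub).trans
    ((Finset.card_biUnion_le_card_mul _ _ (h * (K + 1)) fun j _ => ?_).trans ?_)
  · refine (Finset.card_biUnion_le_card_mul _ _ (K + 1) fun i _ => hcard j i).trans ?_
    simp
  · simp

end ThinBasis

/-- Cassels' theorem: additive eigenvalues exist for every order `h ≥ 2`. -/
theorem exists_isAdditiveEigenvalue {h : ℕ} (hh : 2 ≤ h) : ∃ α, IsAdditiveEigenvalue h α := by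
  have hh0 : h ≠ 0 := by omega
  obtain ⟨C, hC, hwin⟩ := thinBasis_window_bound hh0
  obtain ⟨B, hAB, hB⟩ := exists_superset_of_window_bound hh hC hwin
  have hCr : (0 : ℝ) < C := by exact_mod_cast hC
  refine ⟨((C : ℝ)⁻¹) ^ h, (isAdditiveEigenvalue_iff hh0).2
    ⟨by positivity, B, (isAsymptoticBasis_thinBasis hh0).mono hAB, ?_⟩⟩
  rwa [Real.pow_rpow_inv_natCast (by positivity) hh0, inv_inv]

lemma IsAdditiveEigenvalue.of_lt {h : ℕ} (hh : 2 ≤ h) {α β : ℝ} (hα : IsAdditiveEigenvalue h α)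
    (hβ : 0 < β) (hlt : β < α) : IsAdditiveEigenvalue h β := by
  have hh0 : h ≠ 0 := by omega
  obtain ⟨hα0, A, hA, hc⟩ := (isAdditiveEigenvalue_iff hh0).1 hα
  obtain ⟨B, hAB, hB⟩ := hc.exists_superset hh (γ := (β ^ (h : ℝ)⁻¹)⁻¹) (by positivity) (by gcongr)
  exact (isAdditiveEigenvalue_iff hh0).2 ⟨hβ, B, hA.mono hAB, hB⟩

/-- For every `h ≥ 2` the additive spectrum of order `h` is an interval `(0, η_h)` or
`(0, η_h]` with `0 < η_h ≤ 1/h!`. -/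
theorem stmt18 (h : ℕ) (hh : 2 ≤ h) :
    ∃ η : ℝ, 0 < η ∧ η ≤ 1 / Nat.factorial h ∧
      ({α : ℝ | IsAdditiveEigenvalue h α} = Set.Ioo 0 η ∨
        {α : ℝ | IsAdditiveEigenvalue h α} = Set.Ioc 0 η) := by
  have hh0 : h ≠ 0 := by omega
  have hpos : ∀ α, IsAdditiveEigenvalue h α → 0 < α := fun α hα =>
    ((isAdditiveEigenvalue_iff hh0).1 hα).1
  have hle : ∀ α, IsAdditiveEigenvalue h α → α ≤ 1 / h.factorial := fun α hα => by
    obtain ⟨h1, A, hA, hc⟩ := (isAdditiveEigenvalue_iff hh0).1 hα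
    exact le_one_div_factorial hh0 h1 hA hc
  obtain ⟨α₀, hα₀⟩ := exists_isAdditiveEigenvalue hh
  set N := {α : ℝ | IsAdditiveEigenvalue h α} with hN
  have hbdd : BddAbove N := ⟨_, fun α hα => hle α hα⟩
  have hdown : Set.Ioo 0 (sSup N) ⊆ N := fun β hβ => by
    obtain ⟨α, hα, hlt⟩ := exists_lt_of_lt_csSup ⟨α₀, hα₀⟩ hβ.2
    exact IsAdditiveEigenvalue.of_lt hh hα hβ.1 hlt
  refine ⟨sSup N, (hpos _ hα₀).trans_le (le_csSup hbdd hα₀), csSup_le ⟨α₀, hα₀⟩ hle, ?_⟩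
  by_cases hmem : sSup N ∈ N
  · right
    refine Set.Subset.antisymm (fun α hα => ⟨hpos α hα, le_csSup hbdd hα⟩) fun β hβ => ?_
    rcases hβ.2.lt_or_eq with hlt | heq
    · exact hdown ⟨hβ.1, hlt⟩
    · rwa [heq]
  · left
    refine Set.Subset.antisymm (fun α hα => ⟨hpos α hα, (le_csSup hbdd hα).lt_of_ne ?_⟩) hdown
    rintro rfl
    exact hmem hα
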